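/- arXiv:2005.07015 — 3 statements merged into one kernel-verified Lean document; each statement's English description precedes it below -/
import Mathlib

section
/- Let p, q be positive reals and let g : ℝ → ℝ be a nonnegative measurable function. Then ∫₀^∞ ∫₀^∞ x^(-1/2)·y^(-1/2) · g(xy/(x+y)) · exp(-p·x - q·y) dx dy = (√π·(√p+√q)/(√p·√q)) · ∫₀^∞ t^(-1/2) · g(t) · exp(-(√p+√q)²·t) dt. -/
open MeasureTheory Real

lemma aux_inv (c : ℝ) (hc : 0 < c) (f : ℝ → ENNReal) :
    ∫⁻ y in Set.Ioi (0:ℝ), f y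
      = ∫⁻ s in Set.Ioi (0:ℝ), ENNReal.ofReal (c / s ^ 2) * f (c / s) := by
  have him : (fun s : ℝ => c / s) '' Set.Ioi 0 = Set.Ioi 0 := by
    ext y
    simp only [Set.mem_image, Set.mem_Ioi]
    constructor
    · rintro ⟨s, hs, rfl⟩
      positivity
    · intro hy
      exact ⟨c / y, by positivity, by field_simp⟩
  have h := lintegral_image_eq_lintegral_abs_deriv_mul (s := Set.Ioi (0:ℝ))
    (f := fun s => c / s) (f' := fun s => -(c / s ^ 2)) measurableSet_Ioi
    (by
      intro s hs
      have hs' : s ≠ 0 := ne_of_gt hs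
      have := ((hasDerivAt_inv hs').const_mul c).hasDerivWithinAt (s := Set.Ioi 0)
      exact this.congr_deriv (by field_simp))
    (by
      intro a ha b hb hab
      have ha' : a ≠ 0 := ne_of_gt ha
      have hb' : b ≠ 0 := ne_of_gt hb
      have hab' : c / a = c / b := hab
      field_simp at hab'
      linarith) f
  rw [him] at h
  rw [h]
  refine setLIntegral_congr_fun measurableSet_Ioi ?_
  intro s hs
  have hs' : 0 < s := hs
  simp only [abs_neg]
  rw [abs_of_pos (by positivity)]

lemma aux_mul (c : ℝ) (hc : 0 < c) (f : ℝ → ENNReal) :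
    ∫⁻ y in Set.Ioi (0:ℝ), f y
      = ∫⁻ s in Set.Ioi (0:ℝ), ENNReal.ofReal c * f (c * s) := by
  have him : (fun s : ℝ => c * s) '' Set.Ioi 0 = Set.Ioi 0 := by
    ext y
    simp only [Set.mem_image, Set.mem_Ioi]
    constructor
    · rintro ⟨s, hs, rfl⟩
      positivity
    · intro hy
      exact ⟨y / c, by positivity, by field_simp⟩
  have h := lintegral_image_eq_lintegral_abs_deriv_mul (s := Set.Ioi (0:ℝ))
    (f := fun s => c * s) (f' := fun _ => c) measurableSet_Ioi
    (by
      intro s hs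
      simpa using ((hasDerivAt_id s).const_mul c).hasDerivWithinAt (s := Set.Ioi 0))
    (by
      intro a ha b hb hab
      exact mul_left_cancel₀ hc.ne' hab) f
  rw [him] at h
  rw [h, abs_of_pos hc]

lemma aux_gauss : ∫⁻ v : ℝ, ENNReal.ofReal (Real.exp (-v ^ 2)) = ENNReal.ofReal (√π) := by
  have h1 := integral_gaussian 1
  have h2 := integrable_exp_neg_mul_sq (b := 1) one_pos
  rw [← ofReal_integral_eq_lintegral_ofReal]
  · congr 1
    simpa using h1
  · simpa using h2
  · exact Filter.Eventually.of_forall fun v => (Real.exp_pos _).le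

/-- The Cauchy and Schlomilch substitution -/
lemma aux_cs (a b : ℝ) (ha : 0 < a) (hb : 0 < b) :
    ∫⁻ s in Set.Ioi (0:ℝ), ENNReal.ofReal ((a / (2 * √s) + b / (2 * (s * √s))) *
      Real.exp (-(a * √s - b / √s) ^ 2)) = ENNReal.ofReal (√π) := by
  have him : (fun s : ℝ => a * √s - b / √s) '' Set.Ioi 0 = Set.univ := by
    ext v
    simp only [Set.mem_image, Set.mem_Ioi, Set.mem_univ, iff_true]
    set r := √(v ^ 2 + 4 * a * b) with hr
    have hr2 : r ^ 2 = v ^ 2 + 4 * a * b := Real.sq_sqrt (by positivity)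
    have hr0 : |v| < r := by
      apply Real.lt_sqrt_of_sq_lt
      rw [sq_abs]
      have := mul_pos ha hb
      linarith
    have hw : 0 < (v + r) / (2 * a) := by
      have := neg_abs_le v
      apply div_pos <;> linarith
    have hvr : v + r ≠ 0 := by
      have := neg_abs_le v
      linarith
    refine ⟨((v + r) / (2 * a)) ^ 2, by positivity, ?_⟩
    rw [Real.sqrt_sq hw.le]
    field_simp
    linarith
  have h := lintegral_image_eq_lintegral_abs_deriv_mul (s := Set.Ioi (0:ℝ))
    (f := fun s => a * √s - b / √s)
    (f' := fun s => a / (2 * √s) + b / (2 * (s * √s))) measurableSet_Ioi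
    (by
      intro s hs
      have hs0 : 0 < s := hs
      have hq : 0 < √s := Real.sqrt_pos.2 hs0
      have h1 := Real.hasDerivAt_sqrt hs0.ne'
      have h2 := ((h1.const_mul a).sub ((h1.inv hq.ne').const_mul b)).hasDerivWithinAt
        (s := Set.Ioi 0)
      refine h2.congr_deriv ?_
      rw [Real.sq_sqrt hs0.le]
      field_simp
      try ring)
    (by
      intro x hx y hy hxy
      have hx' : 0 < √x := Real.sqrt_pos.2 hx
      have hy' : 0 < √y := Real.sqrt_pos.2 hy
      have hxy' : a * √x - b / √x = a * √y - b / √y := hxy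
      have h3 : (√x - √y) * (a * (√x * √y) + b) = 0 := by
        field_simp at hxy'
        linarith
      have h4 : √x = √y := by
        rcases mul_eq_zero.1 h3 with h | h
        · linarith
        · have : 0 < a * (√x * √y) + b := by positivity
          linarith
      exact (Real.sqrt_inj (le_of_lt hx) (le_of_lt hy)).1 h4)
    (fun v => ENNReal.ofReal (Real.exp (-v ^ 2)))
  rw [him, Measure.restrict_univ, aux_gauss] at h
  rw [h]
  refine setLIntegral_congr_fun measurableSet_Ioi ?_
  intro s hs
  have hs' : 0 < s := hs
  have hq : 0 < √s := Real.sqrt_pos.2 hs'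
  simp only
  rw [abs_of_pos (by positivity), ENNReal.ofReal_mul (by positivity)]

lemma aux_sq (a b s : ℝ) (hs : 0 < s) :
    -(a * √s - b / √s) ^ 2 = 2 * a * b - (a ^ 2 * s + b ^ 2 / s) := by
  have hq : 0 < √s := Real.sqrt_pos.2 hs
  have h : s = √s ^ 2 := (Real.sq_sqrt hs.le).symm
  have h2 : a ^ 2 * s + b ^ 2 / s = a ^ 2 * √s ^ 2 + b ^ 2 / √s ^ 2 := by rw [← h]
  rw [h2]
  field_simp
  ring

lemma aux_sym (a b : ℝ) (ha : 0 < a) (hb : 0 < b) :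
    ∫⁻ s in Set.Ioi (0:ℝ), ENNReal.ofReal ((a / (2 * √s)) *
      Real.exp (-(a * √s - b / √s) ^ 2)) =
    ∫⁻ s in Set.Ioi (0:ℝ), ENNReal.ofReal ((b / (2 * (s * √s))) *
      Real.exp (-(a * √s - b / √s) ^ 2)) := by
  have hc : 0 < (b / a) ^ 2 := by positivity
  rw [aux_inv _ hc]
  refine setLIntegral_congr_fun measurableSet_Ioi ?_
  intro s hs
  have hs' : 0 < s := hs
  have hq : 0 < √s := Real.sqrt_pos.2 hs'
  simp only
  rw [← ENNReal.ofReal_mul (by positivity)]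
  have e : √((b / a) ^ 2 / s) = (b / a) / √s := by
    rw [Real.sqrt_div (by positivity), Real.sqrt_sq (by positivity)]
  rw [e]
  have e2 : (a * (b / a / √s) - b / (b / a / √s)) ^ 2 = (a * √s - b / √s) ^ 2 := by
    field_simp
    ring
  rw [e2, ← mul_assoc]
  congr 2
  have h : √s ^ 2 = s := Real.sq_sqrt hs'.le
  field_simp
  linarith

lemma aux_B (a b : ℝ) (ha : 0 < a) (hb : 0 < b) :
    ∫⁻ s in Set.Ioi (0:ℝ), ENNReal.ofReal ((b / (2 * (s * √s))) *
      Real.exp (-(a * √s - b / √s) ^ 2)) = ENNReal.ofReal (√π / 2) := by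
  have h := aux_cs a b ha hb
  have h2 : ∫⁻ s in Set.Ioi (0:ℝ), ENNReal.ofReal ((a / (2 * √s) + b / (2 * (s * √s))) *
      Real.exp (-(a * √s - b / √s) ^ 2)) =
      ∫⁻ s in Set.Ioi (0:ℝ), (ENNReal.ofReal ((a / (2 * √s)) *
      Real.exp (-(a * √s - b / √s) ^ 2)) + ENNReal.ofReal ((b / (2 * (s * √s))) *
      Real.exp (-(a * √s - b / √s) ^ 2))) := by
    refine setLIntegral_congr_fun measurableSet_Ioi ?_
    intro s hs
    have hs' : 0 < s := hs
    simp only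
    rw [← ENNReal.ofReal_add (by positivity) (by positivity), add_mul]
  rw [h2, lintegral_add_left (by fun_prop), aux_sym a b ha hb, ← two_mul] at h
  have h3 : ENNReal.ofReal (√π) = 2 * ENNReal.ofReal (√π / 2) := by
    rw [← ENNReal.ofReal_ofNat, ← ENNReal.ofReal_mul (by positivity)]
    congr 1
    ring
  rw [h3] at h
  exact (ENNReal.mul_right_inj (by simp) (by simp)).1 h

lemma aux_key (a b : ℝ) (ha : 0 < a) (hb : 0 < b) :
    ∫⁻ s in Set.Ioi (0:ℝ), ENNReal.ofReal ((1 / √s + 1 / (s * √s)) *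
      Real.exp (-(a ^ 2 * s + b ^ 2 / s))) =
    ENNReal.ofReal (√π * (1 / a + 1 / b) * Real.exp (-(2 * a * b))) := by
  have h2 : ∫⁻ s in Set.Ioi (0:ℝ), ENNReal.ofReal ((1 / √s + 1 / (s * √s)) *
      Real.exp (-(a ^ 2 * s + b ^ 2 / s))) =
      ∫⁻ s in Set.Ioi (0:ℝ), (ENNReal.ofReal (2 / a * Real.exp (-(2 * a * b))) *
        ENNReal.ofReal ((a / (2 * √s)) *
      Real.exp (-(a * √s - b / √s) ^ 2)) + ENNReal.ofReal (2 / b * Real.exp (-(2 * a * b))) *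
        ENNReal.ofReal ((b / (2 * (s * √s))) *
      Real.exp (-(a * √s - b / √s) ^ 2))) := by
    refine setLIntegral_congr_fun measurableSet_Ioi ?_
    intro s hs
    have hs' : 0 < s := hs
    simp only
    have hq : 0 < √s := Real.sqrt_pos.2 hs'
    rw [← ENNReal.ofReal_mul (by positivity), ← ENNReal.ofReal_mul (by positivity),
      ← ENNReal.ofReal_add (by positivity) (by positivity), aux_sq a b s hs']
    have e : Real.exp (-(a ^ 2 * s + b ^ 2 / s)) =
      Real.exp (-(2 * a * b)) * Real.exp (2 * a * b - (a ^ 2 * s + b ^ 2 / s)) := by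
      rw [← Real.exp_add]
      congr 1
      ring
    rw [e]
    congr 1
    generalize Real.exp (2 * a * b - (a ^ 2 * s + b ^ 2 / s)) = Y
    generalize Real.exp (-(2 * a * b)) = X
    field_simp
  rw [h2, lintegral_add_left (by fun_prop), lintegral_const_mul _ (by fun_prop),
    lintegral_const_mul _ (by fun_prop), aux_sym a b ha hb, aux_B a b ha hb,
    ← ENNReal.ofReal_mul (by positivity), ← ENNReal.ofReal_mul (by positivity),
      ← ENNReal.ofReal_add (by positivity) (by positivity)]
  congr 1
  field_simp

lemma aux_rpow (x : ℝ) (hx : 0 < x) : x ^ (-(1:ℝ)/2) = 1 / √x := by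
  rw [neg_div, Real.rpow_neg hx.le, Real.sqrt_eq_rpow]
  simp only [one_div]

theorem stmt_1 (p q : ℝ) (hp : 0 < p) (hq : 0 < q) (g : ℝ → ℝ)
    (hg : Measurable g) (hg0 : ∀ t, 0 ≤ g t) :
    (∫⁻ x in Set.Ioi (0:ℝ), ∫⁻ y in Set.Ioi (0:ℝ),
        ENNReal.ofReal (x ^ (-(1:ℝ)/2) * y ^ (-(1:ℝ)/2) * g (x * y / (x + y)) *
          Real.exp (-p * x - q * y)))
    = ENNReal.ofReal (Real.sqrt Real.pi * (Real.sqrt p + Real.sqrt q) /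
        (Real.sqrt p * Real.sqrt q)) *
      ∫⁻ t in Set.Ioi (0:ℝ),
        ENNReal.ofReal (t ^ (-(1:ℝ)/2) * g t *
          Real.exp (-(Real.sqrt p + Real.sqrt q) ^ 2 * t)) := by
  have s1 : ∀ x ∈ Set.Ioi (0:ℝ), (∫⁻ y in Set.Ioi (0:ℝ),
        ENNReal.ofReal (x ^ (-(1:ℝ)/2) * y ^ (-(1:ℝ)/2) * g (x * y / (x + y)) *
          Real.exp (-p * x - q * y))) =
      ∫⁻ s in Set.Ioi (0:ℝ), ENNReal.ofReal (x / s ^ 2) *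
        ENNReal.ofReal (x ^ (-(1:ℝ)/2) * (x / s) ^ (-(1:ℝ)/2) * g (x * (x / s) / (x + x / s)) *
          Real.exp (-p * x - q * (x / s))) := fun x hx => aux_inv x hx _
  rw [setLIntegral_congr_fun measurableSet_Ioi s1, lintegral_lintegral_swap (by
    apply Measurable.aemeasurable
    unfold Function.uncurry
    fun_prop)]
  have s2 : ∀ s ∈ Set.Ioi (0:ℝ), (∫⁻ x in Set.Ioi (0:ℝ), ENNReal.ofReal (x / s ^ 2) *
        ENNReal.ofReal (x ^ (-(1:ℝ)/2) * (x / s) ^ (-(1:ℝ)/2) * g (x * (x / s) / (x + x / s)) *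
          Real.exp (-p * x - q * (x / s)))) =
      ∫⁻ t in Set.Ioi (0:ℝ), ENNReal.ofReal (g t * Real.exp (-(p + q) * t)) *
        ENNReal.ofReal ((1 / √s + 1 / (s * √s)) *
      Real.exp (-((√(p * t)) ^ 2 * s + (√(q * t)) ^ 2 / s))) := by
    intro s hs
    have hs' : 0 < s := hs
    rw [aux_mul (1 + s) (by linarith)]
    refine setLIntegral_congr_fun measurableSet_Ioi ?_
    intro t ht
    have ht' : 0 < t := ht
    have hc : 0 < 1 + s := by linarith
    have hx : 0 < (1 + s) * t := by positivity
    have hy : 0 < (1 + s) * t / s := by positivity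
    have hgt := hg0 t
    simp only
    rw [aux_rpow _ hx, aux_rpow _ hy, Real.sq_sqrt (by positivity), Real.sq_sqrt (by positivity)]
    have e1 : (1 + s) * t * ((1 + s) * t / s) / ((1 + s) * t + (1 + s) * t / s) = t := by
      field_simp
      try ring
    rw [e1, ← ENNReal.ofReal_mul (by positivity), ← ENNReal.ofReal_mul (by positivity),
      ← ENNReal.ofReal_mul (by positivity)]
    congr 1
    have e2 : Real.exp (-p * ((1 + s) * t) - q * ((1 + s) * t / s)) =
        Real.exp (-(p + q) * t) * Real.exp (-(p * t * s + q * t / s)) := by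
      rw [← Real.exp_add]
      congr 1
      field_simp
      ring
    rw [e2, Real.sqrt_div hx.le]
    generalize Real.exp (-(p + q) * t) = X
    generalize Real.exp (-(p * t * s + q * t / s)) = Y
    have h1 : √((1 + s) * t) ^ 2 = (1 + s) * t := Real.sq_sqrt hx.le
    have h2 : √s ^ 2 = s := Real.sq_sqrt hs'.le
    have hw : 0 < √((1 + s) * t) := Real.sqrt_pos.2 hx
    have hz : 0 < √s := Real.sqrt_pos.2 hs'
    generalize √((1 + s) * t) = w at *
    have e3 : (1 + s) * ((1 + s) * t / s ^ 2 * (1 / w * (1 / (w / √s)))) =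
        1 / √s + 1 / (s * √s) := by
      rw [← h1]
      generalize √s = z at *
      subst h2
      field_simp
      try ring
    rw [← e3]
    ring
  rw [setLIntegral_congr_fun measurableSet_Ioi s2, lintegral_lintegral_swap (by
    apply Measurable.aemeasurable
    unfold Function.uncurry
    fun_prop), ← lintegral_const_mul _ (by fun_prop)]
  refine setLIntegral_congr_fun measurableSet_Ioi ?_
  intro t ht
  have ht' : 0 < t := ht
  have hgt := hg0 t
  have h1 : 0 < √p := Real.sqrt_pos.2 hp
  have h2 : 0 < √q := Real.sqrt_pos.2 hq
  have h3 : 0 < √t := Real.sqrt_pos.2 ht'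
  simp only
  rw [lintegral_const_mul _ (by fun_prop), aux_key _ _ (by positivity) (by positivity),
    ← ENNReal.ofReal_mul (by positivity), ← ENNReal.ofReal_mul (by positivity), aux_rpow _ ht',
    Real.sqrt_mul hp.le, Real.sqrt_mul hq.le]
  congr 1
  have e : Real.exp (-(√p + √q) ^ 2 * t) =
      Real.exp (-(p + q) * t) * Real.exp (-(2 * (√p * √t) * (√q * √t))) := by
    rw [← Real.exp_add]
    congr 1
    have a1 : √p ^ 2 = p := Real.sq_sqrt hp.le
    have a2 : √q ^ 2 = q := Real.sq_sqrt hq.le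
    have a3 : √t ^ 2 = t := Real.sq_sqrt ht'.le
    linear_combination (-t) * a1 - t * a2 + 2 * √p * √q * a3
  rw [e]
  generalize Real.exp (-(p + q) * t) = X
  generalize Real.exp (-(2 * (√p * √t) * (√q * √t))) = Y
  field_simp
  try ring
end

section
/- Let p, q be positive reals and let f : ℝ → ℝ be a nonnegative measurable function. Then ∫₀^∞ ∫₀^∞ x^(-1/2)·y^(-1/2)·(x+y)^(-1/2) · f(xy/(x+y)) · exp(-p·x - q·y) dx dy = 2 · ∫₀^∞ f(t) · t^(-1/2) · exp(-(p+q)·t) · K₀(2·√p·√q·t) dt. -/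
open MeasureTheory Real

/-- Modified Bessel function of the second kind, via its integral representation
`K_ν(z) = ∫₀^∞ exp(-z cosh u) cosh (ν u) du`. -/
noncomputable def besselK (ν : ℝ) (z : ℝ) : ℝ :=
  ∫ u in Set.Ioi (0:ℝ), Real.exp (-z * Real.cosh u) * Real.cosh (ν * u)

lemma aux_scale (c : ℝ) (hc : 0 < c) (g : ℝ → ENNReal) :
    ∫⁻ x in Set.Ioi (0:ℝ), g x = ∫⁻ x in Set.Ioi (0:ℝ), ENNReal.ofReal c * g (c * x) := by
  have him : Set.image (fun x : ℝ => c * x) (Set.Ioi 0) = Set.Ioi 0 := by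
    ext y
    simp only [Set.mem_image, Set.mem_Ioi]
    constructor
    · rintro ⟨x, hx, rfl⟩
      positivity
    · intro hy
      exact ⟨y / c, by positivity, by field_simp⟩
  have h := lintegral_image_eq_lintegral_abs_deriv_mul (s := Set.Ioi (0:ℝ))
    (f := fun x : ℝ => c * x) (f' := fun _ => c) measurableSet_Ioi
    (fun x _ => by simpa using ((hasDerivAt_id x).const_mul c).hasDerivWithinAt)
    (fun x _ y _ hxy => mul_left_cancel₀ hc.ne' hxy) g
  rw [him] at h
  rw [h, abs_of_pos hc]

lemma aux_exp (c : ℝ) (hc : 0 < c) (g : ℝ → ENNReal) :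
    ∫⁻ x in Set.Ioi (0:ℝ), g x = ∫⁻ u, ENNReal.ofReal (c * exp u) * g (c * exp u) := by
  have him : Set.image (fun x : ℝ => c * exp x) (Set.univ) = Set.Ioi 0 := by
    ext y
    simp only [Set.mem_image, Set.mem_Ioi, Set.mem_univ, true_and]
    constructor
    · rintro ⟨x, rfl⟩
      positivity
    · intro hy
      exact ⟨log (y / c), by rw [exp_log (by positivity)]; field_simp⟩
  have h := lintegral_image_eq_lintegral_abs_deriv_mul (s := Set.univ)
    (f := fun x : ℝ => c * exp x) (f' := fun x => c * exp x) MeasurableSet.univ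
    (fun x _ => ((hasDerivAt_exp x).const_mul c).hasDerivWithinAt)
    (fun x _ y _ hxy => exp_injective (mul_left_cancel₀ hc.ne' hxy)) g
  rw [him, Measure.restrict_univ] at h
  rw [h]
  refine lintegral_congr fun u => ?_
  rw [abs_of_pos (by positivity)]

lemma aux_bessel (z : ℝ) (hz : 0 < z) :
    ∫⁻ u, ENNReal.ofReal (exp (-z * cosh u)) = 2 * ENNReal.ofReal (besselK 0 z) := by
  have hint : Integrable (fun u => exp (-z * cosh u)) (volume.restrict (Set.Ioi (0:ℝ))) := by
    have h0 : IntegrableOn (fun u : ℝ => exp (-(z/2) * u)) (Set.Ioi 0) :=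
      exp_neg_integrableOn_Ioi 0 (by positivity)
    refine Integrable.mono' h0 (by fun_prop) (Filter.Eventually.of_forall fun u => ?_)
    rw [norm_of_nonneg (exp_pos _).le]
    apply exp_le_exp.2
    have h1 : u / 2 ≤ cosh u := by
      rw [cosh_eq]
      have := add_one_le_exp u
      have := exp_pos (-u)
      linarith
    nlinarith
  have hK : ENNReal.ofReal (besselK 0 z) =
      ∫⁻ u in Set.Ioi (0:ℝ), ENNReal.ofReal (exp (-z * cosh u)) := by
    unfold besselK
    simp only [zero_mul, cosh_zero, mul_one]
    exact ofReal_integral_eq_lintegral_ofReal hint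
      (Filter.Eventually.of_forall fun u => (exp_pos _).le)
  rw [hK, ← lintegral_add_compl _ (measurableSet_Ioi (a := (0:ℝ))), two_mul]
  congr 1
  rw [Set.compl_Ioi, setLIntegral_congr (Iio_ae_eq_Iic (a := (0:ℝ))).symm]
  have him : Set.image (fun x : ℝ => -x) (Set.Ioi 0) = Set.Iio 0 := by simp
  have h := lintegral_image_eq_lintegral_abs_deriv_mul (s := Set.Ioi (0:ℝ))
    (f := fun x : ℝ => -x) (f' := fun _ => -1) measurableSet_Ioi
    (fun x _ => (hasDerivAt_neg x).hasDerivWithinAt)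
    (fun x _ y _ hxy => neg_injective hxy) (fun u => ENNReal.ofReal (exp (-z * cosh u)))
  rw [him] at h
  rw [h]
  simp

lemma aux_rpow_s5 (t w : ℝ) (ht : 0 < t) (hw : 0 < w) :
    ((1 + w) / w) * (((1 + w) / w * t) * w) *
      (((1 + w) / w * t) ^ (-(1:ℝ)/2) * (((1 + w) / w * t) * w) ^ (-(1:ℝ)/2) *
        (((1 + w) / w * t) + ((1 + w) / w * t) * w) ^ (-(1:ℝ)/2)) = t ^ (-(1:ℝ)/2) := by
  rw [← mul_rpow (by positivity) (by positivity), ← mul_rpow (by positivity) (by positivity)]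
  have h : ((1 + w) / w * t) * (((1 + w) / w * t) * w) *
      (((1 + w) / w * t) + ((1 + w) / w * t) * w) = t * (t * (1 + w)^2 / w)^(2:ℝ) := by
    rw [rpow_two]; field_simp
  rw [h, mul_rpow (by positivity) (by positivity), ← rpow_mul (by positivity)]
  norm_num
  rw [rpow_neg_one]
  field_simp

lemma aux_point (p q : ℝ) (hp : 0 < p) (hq : 0 < q) (f : ℝ → ℝ) (t v w : ℝ) (ht : 0 < t)
    (hw : w = √p / √q * exp v) :
    ENNReal.ofReal ((1 + w) / w) * (ENNReal.ofReal (((1 + w) / w * t) * w) *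
      ENNReal.ofReal (((1 + w) / w * t) ^ (-(1:ℝ)/2) * (((1 + w) / w * t) * w) ^ (-(1:ℝ)/2) *
        (((1 + w) / w * t) + ((1 + w) / w * t) * w) ^ (-(1:ℝ)/2) *
        f (((1 + w) / w * t) * (((1 + w) / w * t) * w) /
          (((1 + w) / w * t) + ((1 + w) / w * t) * w)) *
        exp (-p * ((1 + w) / w * t) - q * (((1 + w) / w * t) * w)))) =
    ENNReal.ofReal (f t * t ^ (-(1:ℝ)/2) * exp (-(p + q) * t) *
      exp (-(2 * √p * √q * t) * cosh v)) := by
  have hw0 : 0 < w := by rw [hw]; positivity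
  rw [← ENNReal.ofReal_mul (by positivity), ← ENNReal.ofReal_mul (by positivity)]
  congr 1
  have e1 : ((1 + w) / w * t) * (((1 + w) / w * t) * w) /
          (((1 + w) / w * t) + ((1 + w) / w * t) * w) = t := by
    field_simp
  have e2 : exp (-p * ((1 + w) / w * t) - q * (((1 + w) / w * t) * w)) =
      exp (-(p + q) * t) * exp (-(2 * √p * √q * t) * cosh v) := by
    rw [← exp_add]
    congr 1
    have hp2 : p / w = √p * √q * exp (-v) := by
      rw [hw, exp_neg]
      have := sq_sqrt hp.le
      field_simp
      exact this.symm
    have hq2 : q * w = √p * √q * exp v := by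
      rw [hw]
      have := sq_sqrt hq.le
      field_simp
      linear_combination -this
    have : -p * ((1 + w) / w * t) - q * (((1 + w) / w * t) * w) =
      -(p + q) * t - t * (p / w) - t * (q * w) := by field_simp; ring
    rw [this, hp2, hq2, cosh_eq]
    ring
  rw [e1, e2]
  linear_combination (f t * (exp (-(p + q) * t) * exp (-(2 * √p * √q * t) * cosh v))) *
    aux_rpow_s5 t w ht hw0

theorem stmt_5 (p q : ℝ) (hp : 0 < p) (hq : 0 < q) (f : ℝ → ℝ)
    (hf : Measurable f) (hf0 : ∀ t, 0 ≤ f t) :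
    (∫⁻ x in Set.Ioi (0:ℝ), ∫⁻ y in Set.Ioi (0:ℝ),
        ENNReal.ofReal (x ^ (-(1:ℝ)/2) * y ^ (-(1:ℝ)/2) * (x + y) ^ (-(1:ℝ)/2) *
          f (x * y / (x + y)) * Real.exp (-p * x - q * y)))
    = 2 *
      ∫⁻ t in Set.Ioi (0:ℝ),
        ENNReal.ofReal (f t * t ^ (-(1:ℝ)/2) * Real.exp (-(p + q) * t) *
          besselK 0 (2 * Real.sqrt p * Real.sqrt q * t)) := by
  set w : ℝ → ℝ := fun v => √p / √q * exp v with hw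
  have hwm : Measurable w := by fun_prop
  have hwpos : ∀ v, 0 < w v := fun v => by simp only [hw]; positivity
  set G : ℝ → ℝ → ENNReal := fun x y => ENNReal.ofReal
    (x ^ (-(1:ℝ)/2) * y ^ (-(1:ℝ)/2) * (x + y) ^ (-(1:ℝ)/2) *
          f (x * y / (x + y)) * Real.exp (-p * x - q * y)) with hG
  calc (∫⁻ x in Set.Ioi (0:ℝ), ∫⁻ y in Set.Ioi (0:ℝ), G x y)
      = ∫⁻ x in Set.Ioi (0:ℝ), ∫⁻ v, ENNReal.ofReal (x * w v) * G x (x * w v) := by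
        refine setLIntegral_congr_fun measurableSet_Ioi fun x hx => ?_
        have hx' : (0:ℝ) < x := hx
        rw [aux_exp (x * (√p / √q)) (by positivity)]
        simp only [hw, mul_assoc]
    _ = ∫⁻ v, ∫⁻ x in Set.Ioi (0:ℝ), ENNReal.ofReal (x * w v) * G x (x * w v) := by
        apply lintegral_lintegral_swap
        apply Measurable.aemeasurable
        simp only [hG, Function.uncurry_def]
        fun_prop
    _ = ∫⁻ v, ∫⁻ t in Set.Ioi (0:ℝ), ENNReal.ofReal (f t * t ^ (-(1:ℝ)/2) *
          exp (-(p + q) * t) * exp (-(2 * √p * √q * t) * cosh v)) := by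
        refine lintegral_congr fun v => ?_
        have := hwpos v
        rw [aux_scale ((1 + w v) / w v) (by positivity)]
        refine setLIntegral_congr_fun measurableSet_Ioi fun t ht => ?_
        exact aux_point p q hp hq f t v (w v) ht rfl
    _ = ∫⁻ t in Set.Ioi (0:ℝ), ∫⁻ v, ENNReal.ofReal (f t * t ^ (-(1:ℝ)/2) *
          exp (-(p + q) * t) * exp (-(2 * √p * √q * t) * cosh v)) := by
        apply lintegral_lintegral_swap
        apply Measurable.aemeasurable
        simp only [Function.uncurry_def]
        fun_prop
    _ = ∫⁻ t in Set.Ioi (0:ℝ), 2 * ENNReal.ofReal (f t * t ^ (-(1:ℝ)/2) *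
          exp (-(p + q) * t) * besselK 0 (2 * √p * √q * t)) := by
        refine setLIntegral_congr_fun measurableSet_Ioi fun t ht => ?_
        have ht' : (0:ℝ) < t := ht
        have hA : 0 ≤ f t * t ^ (-(1:ℝ)/2) * exp (-(p + q) * t) := by
          have := hf0 t
          positivity
        simp only [ENNReal.ofReal_mul hA]
        rw [lintegral_const_mul _ (by fun_prop), aux_bessel _ (by positivity)]
        ring
    _ = _ := lintegral_const_mul' _ _ (by simp)
end

section
/- Let a, b, c be reals with a > b > 0 and c > 0, and let f : ℝ → ℝ be a nonnegative measurable function. Then ∫₀^∞ ∫₀^∞ x^(-1/2)·y^(-3/2)·(x+y)^(-3/2) · f(xy/(x+y)) · exp(-a/x - b/y - c·xy/(x+y)) dx dy = (a-b)^(-2) · ∫₀^∞ f(t) · t^(-3/2) · exp(-c·t) · (t·exp(-a/t) - (-a+b+t)·exp(-b/t)) dt. -/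
open MeasureTheory Real

lemma aux_rpow_s12 (x t s : ℝ) (hx : 0 < x) (ht : 0 < t) (hs : 0 < s) :
    x ^ 2 / s ^ 2 * (x ^ (-(1:ℝ)/2) * (x * t / s) ^ (-(3:ℝ)/2) * (x ^ 2 / s) ^ (-(3:ℝ)/2))
      = t ^ (-(3:ℝ)/2) * ((x ^ 3)⁻¹ * s) := by
  obtain ⟨X, rfl⟩ : ∃ X, Real.exp X = x := ⟨Real.log x, Real.exp_log hx⟩
  obtain ⟨T, rfl⟩ : ∃ X, Real.exp X = t := ⟨Real.log t, Real.exp_log ht⟩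
  obtain ⟨S, rfl⟩ : ∃ X, Real.exp X = s := ⟨Real.log s, Real.exp_log hs⟩
  simp only [← Real.exp_nat_mul, ← Real.exp_add, ← Real.exp_sub, ← Real.exp_neg, ← Real.exp_mul]
  congr 1
  push_cast
  ring

lemma aux_image (x : ℝ) (hx : 0 < x) :
    Set.image (fun t : ℝ => x * t / (x - t)) (Set.Ioo 0 x) = Set.Ioi 0 := by
  ext y
  constructor
  · rintro ⟨t, ⟨h0, h1⟩, rfl⟩
    have : 0 < x - t := by linarith
    exact Set.mem_Ioi.2 (by positivity)
  · intro hy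
    have hy : 0 < y := hy
    refine ⟨x * y / (x + y), ⟨by positivity, ?_⟩, ?_⟩
    · rw [div_lt_iff₀ (by positivity)]; nlinarith [mul_pos hx hx]
    · have h : x - x * y / (x + y) = x ^ 2 / (x + y) := by field_simp; ring
      simp only [h]
      field_simp

lemma aux_inner (a b c : ℝ) (f : ℝ → ℝ) (hf0 : ∀ t, 0 ≤ f t) (x : ℝ) (hx : 0 < x) :
    (∫⁻ y in Set.Ioi (0:ℝ),
        ENNReal.ofReal (x ^ (-(1:ℝ)/2) * y ^ (-(3:ℝ)/2) * (x + y) ^ (-(3:ℝ)/2) *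
          f (x * y / (x + y)) *
          Real.exp (-a / x - b / y - c * (x * y / (x + y)))))
    = ∫⁻ t in Set.Ioo 0 x,
        ENNReal.ofReal (f t * t ^ (-(3:ℝ)/2) * Real.exp (-c * t) * Real.exp (-b / t)) *
        ENNReal.ofReal ((x ^ 3)⁻¹ * (x - t) * Real.exp (-(a - b) / x)) := by
  rw [← aux_image x hx]
  rw [lintegral_image_eq_lintegral_abs_deriv_mul (f' := fun t => x ^ 2 / (x - t) ^ 2)
    measurableSet_Ioo]
  · refine setLIntegral_congr_fun measurableSet_Ioo ?_
    rintro t ⟨h0, h1⟩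
    have hs : 0 < x - t := by linarith
    have e1 : x + x * t / (x - t) = x ^ 2 / (x - t) := by field_simp; ring
    have e2 : x * (x * t / (x - t)) / (x ^ 2 / (x - t)) = t := by field_simp
    have e3 : -a / x - b / (x * t / (x - t)) - c * t = -c * t + -b / t + -(a - b) / x := by
      field_simp; ring
    have hft := hf0 t
    simp only [e1, e2, e3]
    rw [← ENNReal.ofReal_mul (abs_nonneg _), ← ENNReal.ofReal_mul (by positivity),
      abs_of_nonneg (by positivity)]
    congr 1
    rw [Real.exp_add, Real.exp_add]
    have := aux_rpow_s12 x t (x - t) hx h0 hs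
    linear_combination (f t * (Real.exp (-c * t) * Real.exp (-b / t) *
      Real.exp (-(a - b) / x))) * this
  · rintro t ⟨h0, h1⟩
    have hs : x - t ≠ 0 := by linarith
    have := ((hasDerivAt_id t).const_mul x).div ((hasDerivAt_id t).const_sub x) hs
    refine (this.congr_deriv ?_).hasDerivWithinAt
    simp only [id]
    congr 1; ring
  · rintro t ⟨h0, h1⟩ u ⟨h2, h3⟩ h
    have hs : x - t ≠ 0 := by linarith
    have hs : x - u ≠ 0 := by linarith
    simp only at h
    field_simp at h
    have : x * (t - u) = 0 := by linarith
    rcases mul_eq_zero.1 this with h | h <;> linarith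

lemma aux_outer (d : ℝ) (hd : 0 < d) (t : ℝ) (ht : 0 < t) :
    ∫⁻ x in Set.Ioi t, ENNReal.ofReal ((x ^ 3)⁻¹ * (x - t) * Real.exp (-d / x))
      = ENNReal.ofReal ((d ^ 2)⁻¹ * (d - t + t * Real.exp (-d / t))) := by
  set F : ℝ → ℝ := fun x => ((1 - t * x⁻¹) / d - t / d ^ 2) * Real.exp (-d * x⁻¹) with hF
  have hder : ∀ x ∈ Set.Ici t, HasDerivAt F ((x ^ 3)⁻¹ * (x - t) * Real.exp (-d / x)) x := by
    intro x hx
    have hx0 : 0 < x := lt_of_lt_of_le ht hx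
    have hi := hasDerivAt_inv hx0.ne'
    have := ((((hi.const_mul t).const_sub 1).div_const d).sub_const (t / d ^ 2)).mul
      ((hi.const_mul (-d)).exp)
    refine this.congr_deriv ?_
    rw [div_eq_mul_inv (-d) x]
    field_simp
    ring
  have hnn : ∀ x ∈ Set.Ioi t, 0 ≤ (x ^ 3)⁻¹ * (x - t) * Real.exp (-d / x) := by
    intro x hx
    have hx : t < x := hx
    have hx0 : 0 < x := ht.trans hx
    have : 0 < x - t := by linarith
    positivity
  have hlim : Filter.Tendsto F Filter.atTop (nhds (((1 - t * 0) / d - t / d ^ 2) * Real.exp (-d * 0))) := by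
    have hc : Continuous (fun u : ℝ => ((1 - t * u) / d - t / d ^ 2) * Real.exp (-d * u)) := by
      fun_prop
    exact (hc.tendsto 0).comp tendsto_inv_atTop_zero
  have hint := integrableOn_Ioi_deriv_of_nonneg' hder hnn hlim
  have hval := integral_Ioi_of_hasDerivAt_of_nonneg' hder hnn hlim
  rw [← ofReal_integral_eq_lintegral_ofReal hint
    ((ae_restrict_iff' measurableSet_Ioi).2 (Filter.Eventually.of_forall hnn)), hval]
  congr 1
  simp only [hF, div_eq_mul_inv (-d) t]
  simp
  field_simp
  ring

theorem stmt_12 (a b c : ℝ) (hab : a > b) (hb : b > 0) (hc : c > 0) (f : ℝ → ℝ)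
    (hf : Measurable f) (hf0 : ∀ t, 0 ≤ f t) :
    (∫⁻ x in Set.Ioi (0:ℝ), ∫⁻ y in Set.Ioi (0:ℝ),
        ENNReal.ofReal (x ^ (-(1:ℝ)/2) * y ^ (-(3:ℝ)/2) * (x + y) ^ (-(3:ℝ)/2) *
          f (x * y / (x + y)) *
          Real.exp (-a / x - b / y - c * (x * y / (x + y)))))
    = ENNReal.ofReal ((a - b) ^ (-(2:ℝ))) *
      ∫⁻ t in Set.Ioi (0:ℝ),
        ENNReal.ofReal (f t * t ^ (-(3:ℝ)/2) * Real.exp (-c * t) *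
          (t * Real.exp (-a / t) - (-a + b + t) * Real.exp (-b / t))) := by
  have hd : 0 < a - b := by linarith
  rw [setLIntegral_congr_fun measurableSet_Ioi (fun x hx => aux_inner a b c f hf0 x hx)]
  set A : ℝ → ENNReal := fun t =>
    ENNReal.ofReal (f t * t ^ (-(3:ℝ)/2) * Real.exp (-c * t) * Real.exp (-b / t)) with hA
  set B : ℝ → ℝ → ENNReal := fun x t =>
    ENNReal.ofReal ((x ^ 3)⁻¹ * (x - t) * Real.exp (-(a - b) / x)) with hB
  have hAm : Measurable A := by
    simp only [hA]; fun_prop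
  have hBm : Measurable (fun p : ℝ × ℝ => B p.1 p.2) := by
    simp only [hB]; fun_prop
  have hS : MeasurableSet {p : ℝ × ℝ | p.2 < p.1} := measurableSet_lt measurable_snd measurable_fst
  have hGm : Measurable (Set.indicator {p : ℝ × ℝ | p.2 < p.1}
      (fun p : ℝ × ℝ => A p.2 * B p.1 p.2)) :=
    ((hAm.comp measurable_snd).mul hBm).indicator hS
  calc ∫⁻ x in Set.Ioi (0:ℝ), ∫⁻ t in Set.Ioo 0 x, A t * B x t
      = ∫⁻ x in Set.Ioi (0:ℝ), ∫⁻ t in Set.Ioi (0:ℝ), Set.indicator {p : ℝ × ℝ | p.2 < p.1}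
          (fun p : ℝ × ℝ => A p.2 * B p.1 p.2) (x, t) := by
        refine lintegral_congr fun x => ?_
        rw [← Set.Iio_inter_Ioi, ← Measure.restrict_restrict measurableSet_Iio,
          ← lintegral_indicator measurableSet_Iio]
        rfl
    _ = ∫⁻ t in Set.Ioi (0:ℝ), ∫⁻ x in Set.Ioi (0:ℝ), Set.indicator {p : ℝ × ℝ | p.2 < p.1}
          (fun p : ℝ × ℝ => A p.2 * B p.1 p.2) (x, t) := by
        exact lintegral_lintegral_swap hGm.aemeasurable
    _ = ∫⁻ t in Set.Ioi (0:ℝ), A t * ∫⁻ x in Set.Ioi t, B x t := by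
        refine setLIntegral_congr_fun measurableSet_Ioi fun t ht => ?_
        have ht : 0 < t := ht
        have hI : Set.Ioi t ∩ Set.Ioi 0 = Set.Ioi t := by
          rw [Set.Ioi_inter_Ioi, sup_of_le_left ht.le]
        rw [← lintegral_const_mul' _ _ ENNReal.ofReal_ne_top, ← hI,
          ← Measure.restrict_restrict measurableSet_Ioi,
          ← lintegral_indicator (measurableSet_Ioi (a := t))]
        rfl
    _ = _ := by
        rw [← lintegral_const_mul' _ _ ENNReal.ofReal_ne_top]
        refine setLIntegral_congr_fun measurableSet_Ioi fun t ht => ?_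
        have ht : 0 < t := ht
        have hft := hf0 t
        simp only [hA, hB]
        rw [aux_outer (a - b) hd t ht, ← ENNReal.ofReal_mul (by positivity),
          ← ENNReal.ofReal_mul (by positivity)]
        congr 1
        have e : Real.exp (-a / t) = Real.exp (-b / t) * Real.exp (-(a - b) / t) := by
          rw [← Real.exp_add]; congr 1; ring
        have e2 : (a - b) ^ (-(2:ℝ)) = ((a - b) ^ 2)⁻¹ := by
          rw [Real.rpow_neg hd.le]; norm_num
        rw [e, e2]
        ring
end
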